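/- (Izergin–Korepin representation, rational case.) Let ν_1,…,ν_N ∈ ℂ be pairwise distinct and λ_1,…,λ_N ∈ ℂ be pairwise distinct with λ_j − ν_k ∉ {0, −1} for all j,k. Then Z_N(λ_1,…,λ_N) = (−1)^{N(N−1)/2} · [∏_{j,k=1}^N (λ_j − ν_k + 1)(λ_j − ν_k)] / [∏_{1≤j<k≤N} (λ_k − λ_j) · ∏_{1≤j<k≤N} (ν_k − ν_j)] · det[ 1 / ((λ_j − ν_k + 1)(λ_j − ν_k)) ]_{j,k=1,…,N}. -/

import Mathlib

open scoped BigOperators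
noncomputable section

namespace SixVertex

/-- A spin configuration of the `N`-site quantum chain: one spin (`0` = up, `1` = down)
at each site. Site `k` of the paper (k = 1,…,N) corresponds to index `k-1 : Fin N`. -/
abbrev Cfg (N : ℕ) := Fin N → Fin 2

/-- Operators on the quantum space `H = (ℂ²)^{⊗N}`, represented as matrices in the
standard (spin-configuration) basis. -/
abbrev Op (N : ℕ) := Matrix (Cfg N) (Cfg N) ℂ

/-- The operator acting as the 2×2 matrix `M` in the `k`-th tensor factor and as the
identity elsewhere. -/
def siteOp {N : ℕ} (k : Fin N) (M : Matrix (Fin 2) (Fin 2) ℂ) : Op N :=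
  Matrix.of fun s s' => if ∀ i, i ≠ k → s i = s' i then M (s k) (s' k) else 0

def piPlus : Matrix (Fin 2) (Fin 2) ℂ := !![1, 0; 0, 0]
def piMinus : Matrix (Fin 2) (Fin 2) ℂ := !![0, 0; 0, 1]
def sigmaPlus : Matrix (Fin 2) (Fin 2) ℂ := !![0, 1; 0, 0]
def sigmaMinus : Matrix (Fin 2) (Fin 2) ℂ := !![0, 0; 1, 0]

/-- Rational weight `a(λ,ν) = λ - ν + 1`. -/
def aW (l v : ℂ) : ℂ := l - v + 1
/-- Rational weight `b(λ,ν) = λ - ν`. -/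
def bW (l v : ℂ) : ℂ := l - v

/-- The L-operator at site `k` (a 2×2 matrix in the auxiliary space, with entries
operators on the quantum space); the weight `c` equals `1`. -/
def Lop {N : ℕ} (ν : Fin N → ℂ) (k : Fin N) (l : ℂ) :
    Matrix (Fin 2) (Fin 2) (Op N) :=
  !![aW l (ν k) • siteOp k piPlus + bW l (ν k) • siteOp k piMinus,
       siteOp k sigmaMinus;
     siteOp k sigmaPlus,
       bW l (ν k) • siteOp k piPlus + aW l (ν k) • siteOp k piMinus]

/-- The monodromy matrix `T(λ) = L_N(λ,ν_N) ⋯ L_1(λ,ν_1)`. -/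
def monodromy {N : ℕ} (ν : Fin N → ℂ) (l : ℂ) :
    Matrix (Fin 2) (Fin 2) (Op N) :=
  (((List.finRange N).reverse).map fun k => Lop ν k l).prod

/-- The operator `A(λ)`. -/
def Aop {N : ℕ} (ν : Fin N → ℂ) (l : ℂ) : Op N := monodromy ν l 0 0
/-- The operator `B(λ)`. -/
def Bop {N : ℕ} (ν : Fin N → ℂ) (l : ℂ) : Op N := monodromy ν l 0 1
/-- The operator `C(λ)`. -/
def Cop {N : ℕ} (ν : Fin N → ℂ) (l : ℂ) : Op N := monodromy ν l 1 0
/-- The operator `D(λ)`. -/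
def Dop {N : ℕ} (ν : Fin N → ℂ) (l : ℂ) : Op N := monodromy ν l 1 1

/-- The all-spins-up configuration. -/
def upCfg (N : ℕ) : Cfg N := fun _ => 0
/-- The all-spins-down configuration. -/
def downCfg (N : ℕ) : Cfg N := fun _ => 1

/-- The basis vector of `H` corresponding to a spin configuration `s`. -/
def basisVec {N : ℕ} (s : Cfg N) : Cfg N → ℂ := Pi.single s 1

/-- The all-spins-up vacuum vector `|⇑⟩`. -/
def upVec (N : ℕ) : Cfg N → ℂ := basisVec (upCfg N)
/-- The all-spins-down vector `|⇓⟩`. -/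
def downVec (N : ℕ) : Cfg N → ℂ := basisVec (downCfg N)

/-- The partition function of the six-vertex model with domain wall boundary conditions:
`Z_N(λ_1,…,λ_N) = ⟨⇓| B(λ_N) ⋯ B(λ_1) |⇑⟩`. -/
def Zfun (N : ℕ) (ν : Fin N → ℂ) (lam : Fin N → ℂ) : ℂ :=
  (((List.finRange N).reverse).map fun j => Bop ν (lam j)).prod (downCfg N) (upCfg N)


/-! ### Helper material -/

def tens {N : ℕ} (X : Op N) (M : Matrix (Fin 2) (Fin 2) ℂ) : Op (N + 1) :=
  Matrix.of fun s s' => M (s (Fin.last N)) (s' (Fin.last N)) *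
    X (fun i => s i.castSucc) (fun i => s' i.castSucc)

lemma sum_cfg {N : ℕ} (f : Cfg (N + 1) → ℂ) :
    ∑ s, f s = ∑ x : Fin 2, ∑ t : Cfg N, f (Fin.snoc (α := fun _ => Fin 2) t x) := by
  rw [← (Fin.snocEquiv (fun _ : Fin (N + 1) => Fin 2)).sum_comp, Fintype.sum_prod_type]
  rfl

lemma tens_mul {N : ℕ} (X Y : Op N) (M M' : Matrix (Fin 2) (Fin 2) ℂ) :
    tens X M * tens Y M' = tens (X * Y) (M * M') := by
  ext s s'
  simp only [tens, Matrix.mul_apply, Matrix.of_apply, sum_cfg, Fin.snoc_last, Fin.snoc_castSucc]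
  rw [Finset.sum_mul_sum]
  refine Finset.sum_congr rfl fun x _ => Finset.sum_congr rfl fun t _ => ?_
  ring

lemma tens_add_left {N : ℕ} (X Y : Op N) (M : Matrix (Fin 2) (Fin 2) ℂ) :
    tens (X + Y) M = tens X M + tens Y M := by
  ext s s'; simp [tens, mul_add]

lemma tens_add_right {N : ℕ} (X : Op N) (M M' : Matrix (Fin 2) (Fin 2) ℂ) :
    tens X (M + M') = tens X M + tens X M' := by
  ext s s'; simp [tens, add_mul]

lemma tens_smul_right {N : ℕ} (X : Op N) (c : ℂ) (M : Matrix (Fin 2) (Fin 2) ℂ) :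
    tens X (c • M) = c • tens X M := by
  ext s s'; simp [tens, mul_assoc]

lemma tens_smul_left {N : ℕ} (X : Op N) (c : ℂ) (M : Matrix (Fin 2) (Fin 2) ℂ) :
    tens (c • X) M = c • tens X M := by
  ext s s'; simp [tens]; ring

lemma tens_one {N : ℕ} : tens (1 : Op N) 1 = 1 := by
  ext s s'
  simp only [tens, Matrix.of_apply, Matrix.one_apply]
  have : s = s' ↔ s (Fin.last N) = s' (Fin.last N) ∧
      (fun i : Fin N => s i.castSucc) = fun i => s' i.castSucc := by
    constructor
    · rintro rfl; simp
    · rintro ⟨h, h'⟩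
      funext i
      refine Fin.lastCases h (fun j => congrFun h' j) i
  by_cases h1 : s (Fin.last N) = s' (Fin.last N) <;>
  by_cases h2 : (fun i : Fin N => s i.castSucc) = fun i => s' i.castSucc <;>
  simp [this, h1, h2]

def liftHom (N : ℕ) : Op N →+* Op (N + 1) where
  toFun X := tens X 1
  map_one' := tens_one
  map_mul' X Y := by rw [tens_mul, one_mul]
  map_zero' := by ext; simp [tens]
  map_add' X Y := tens_add_left X Y 1

lemma siteOp_last {N : ℕ} (M : Matrix (Fin 2) (Fin 2) ℂ) :
    siteOp (Fin.last N) M = tens 1 M := by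
  ext s s'
  have : (∀ i, i ≠ Fin.last N → s i = s' i) ↔
      (fun i : Fin N => s i.castSucc) = fun i => s' i.castSucc := by
    constructor
    · intro h; funext i; exact h _ (Fin.castSucc_lt_last i).ne
    · intro h i
      refine Fin.lastCases (fun h => absurd rfl h) (fun j _ => congrFun h j) i
  simp only [siteOp, tens, Matrix.of_apply, Matrix.one_apply, this]
  split_ifs <;> simp

lemma siteOp_castSucc {N : ℕ} (k : Fin N) (M : Matrix (Fin 2) (Fin 2) ℂ) :
    siteOp k.castSucc M = tens (siteOp k M) 1 := by
  ext s s'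
  have : (∀ i, i ≠ k.castSucc → s i = s' i) ↔ s (Fin.last N) = s' (Fin.last N) ∧
      ∀ i, i ≠ k → s i.castSucc = s' i.castSucc := by
    constructor
    · intro h
      exact ⟨h _ (Fin.castSucc_lt_last k).ne', fun i hi => h _ (by simpa using hi)⟩
    · rintro ⟨h, h'⟩ i
      refine Fin.lastCases (fun _ => h) (fun j hj => h' j (by simpa using hj)) i
  simp only [siteOp, tens, Matrix.of_apply, Matrix.one_apply, this]
  by_cases h1 : s (Fin.last N) = s' (Fin.last N) <;> simp [h1]

/-- local L-matrix -/
def ell (l v : ℂ) : Matrix (Fin 2) (Fin 2) (Matrix (Fin 2) (Fin 2) ℂ) :=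
  !![aW l v • piPlus + bW l v • piMinus, sigmaMinus;
     sigmaPlus, bW l v • piPlus + aW l v • piMinus]

lemma Lop_last {N : ℕ} (ν : Fin (N + 1) → ℂ) (l : ℂ) (a e : Fin 2) :
    Lop ν (Fin.last N) l a e = tens 1 (ell l (ν (Fin.last N)) a e) := by
  fin_cases a <;> fin_cases e <;>
    simp [Lop, ell, siteOp_last, tens_add_right, tens_smul_right]

lemma Lop_castSucc {N : ℕ} (ν : Fin (N + 1) → ℂ) (k : Fin N) (l : ℂ) :
    Lop ν k.castSucc l = (liftHom N).mapMatrix (Lop (fun i => ν i.castSucc) k l) := by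
  ext a e : 2
  fin_cases a <;> fin_cases e <;>
    simp [Lop, liftHom, siteOp_castSucc, tens_add_left, tens_smul_left]

lemma monodromy_succ {N : ℕ} (ν : Fin (N + 1) → ℂ) (l : ℂ) (a c : Fin 2) :
    monodromy ν l a c =
      ∑ e, tens (monodromy (fun i => ν i.castSucc) l e c) (ell l (ν (Fin.last N)) a e) := by
  have h : monodromy ν l = Lop ν (Fin.last N) l *
      (liftHom N).mapMatrix (monodromy (fun i => ν i.castSucc) l) := by
    unfold monodromy
    rw [List.finRange_succ_last, List.reverse_append, List.map_append, map_list_prod]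
    simp only [List.reverse_singleton, List.map_singleton, List.singleton_append, List.prod_cons,
      ← List.map_reverse, List.map_map]
    congr 3
    funext k
    exact Lop_castSucc ν k l
  rw [h, Matrix.mul_apply]
  refine Finset.sum_congr rfl fun e _ => ?_
  rw [Lop_last]
  change _ * tens _ 1 = _
  rw [tens_mul, one_mul, mul_one]

/-- the RTT relation -/
def RTT {R : Type*} [Ring R] [Algebra ℂ R] (u : ℂ) (T T' : Matrix (Fin 2) (Fin 2) R) : Prop :=
  ∀ a b c d, u • (T a c * T' b d) + T b c * T' a d = u • (T' b d * T a c) + T' b c * T a d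

lemma RTT_ell (l m v : ℂ) : RTT (l - m) (ell l v) (ell m v) := by
  intro a b c d
  fin_cases a <;> fin_cases b <;> fin_cases c <;> fin_cases d <;>
    (ext x y; fin_cases x <;> fin_cases y <;>
      simp [ell, piPlus, piMinus, sigmaPlus, sigmaMinus, aW, bW, -mul_eq_mul_left_iff, -mul_eq_mul_right_iff] <;> try ring)

lemma RTT_monodromy {N : ℕ} (ν : Fin N → ℂ) (l m : ℂ) :
    RTT (l - m) (monodromy ν l) (monodromy ν m) := by
  induction N with
  | zero =>
    intro a b c d
    simp only [monodromy, List.finRange_zero, List.reverse_nil, List.map_nil, List.prod_nil,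
      Matrix.one_apply]
    fin_cases a <;> fin_cases b <;> fin_cases c <;> fin_cases d <;> simp
  | succ N ih =>
    intro a b c d
    set u := l - m
    have key := ih (fun i => ν i.castSucc)
    have keyL := RTT_ell l m (ν (Fin.last N))
    change RTT u _ _ at keyL
    simp only [monodromy_succ, Finset.sum_mul_sum, tens_mul]
    set T := monodromy (fun i => ν i.castSucc) l
    set T' := monodromy (fun i => ν i.castSucc) m
    set L := ell l (ν (Fin.last N))
    set L' := ell m (ν (Fin.last N))
    have h1 : u • ∑ e, ∑ f, tens (T e c * T' f d) (L a e * L' b f) +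
        ∑ e, ∑ f, tens (T e c * T' f d) (L b e * L' a f) =
        u • ∑ e, ∑ f, tens (T e c * T' f d) (L' b f * L a e) +
        ∑ e, ∑ f, tens (T e c * T' f d) (L' b e * L a f) := by
      simp only [Finset.smul_sum, ← Finset.sum_add_distrib, ← tens_smul_right, ← tens_add_right]
      refine Finset.sum_congr rfl fun e _ => Finset.sum_congr rfl fun f _ => ?_
      rw [keyL a b e f]
    have h2 : u • ∑ e, ∑ f, tens (T e c * T' f d) (L' b f * L a e) +
        ∑ f, ∑ e, tens (T f c * T' e d) (L' b f * L a e) =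
        u • ∑ e, ∑ f, tens (T' f d * T e c) (L' b f * L a e) +
        ∑ e, ∑ f, tens (T' f c * T e d) (L' b f * L a e) := by
      rw [Finset.sum_comm (f := fun f e => tens (T f c * T' e d) (L' b f * L a e))]
      simp only [Finset.smul_sum, ← Finset.sum_add_distrib, ← tens_smul_left, ← tens_add_left]
      refine Finset.sum_congr rfl fun e _ => Finset.sum_congr rfl fun f _ => ?_
      rw [key e f c d]
    rw [h1, h2, Finset.sum_comm (f := fun e f => tens (T' f d * T e c) (L' b f * L a e)),
      Finset.sum_comm (f := fun e f => tens (T' f c * T e d) (L' b f * L a e))]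

lemma Bop_commute {N : ℕ} (ν : Fin N → ℂ) (l m : ℂ) : Commute (Bop ν l) (Bop ν m) := by
  have h1 := RTT_monodromy ν l m 0 0 1 1
  have h2 := RTT_monodromy ν m l 0 0 1 1
  change (l - m) • (Bop ν l * Bop ν m) + Bop ν l * Bop ν m =
    (l - m) • (Bop ν m * Bop ν l) + Bop ν m * Bop ν l at h1
  change (m - l) • (Bop ν m * Bop ν l) + Bop ν m * Bop ν l =
    (m - l) • (Bop ν l * Bop ν m) + Bop ν l * Bop ν m at h2
  unfold Commute SemiconjBy
  ext s s'
  have e1 := congrFun (congrFun h1 s) s'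
  have e2 := congrFun (congrFun h2 s) s'
  simp only [Matrix.add_apply, Matrix.smul_apply, smul_eq_mul] at e1 e2
  linear_combination (e1 - e2) / 2

/-- bottom row of `D` -/
lemma Dop_down {N : ℕ} (ν : Fin N → ℂ) (l : ℂ) (s : Cfg N) :
    Dop ν l (downCfg N) s = if s = downCfg N then ∏ k, aW l (ν k) else 0 := by
  induction N with
  | zero =>
    have : s = downCfg 0 := Subsingleton.elim _ _
    simp [Dop, monodromy, this]
  | succ N ih =>
    have ih' := ih (fun i => ν i.castSucc) (fun i => s i.castSucc)
    unfold Dop at ih' ⊢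
    rw [monodromy_succ, Matrix.sum_apply, Fin.sum_univ_two]
    have hd : (fun i : Fin N => downCfg (N + 1) i.castSucc) = downCfg N := rfl
    have hs : s = downCfg (N + 1) ↔ s (Fin.last N) = 1 ∧
        (fun i : Fin N => s i.castSucc) = downCfg N := by
      constructor
      · rintro rfl; exact ⟨rfl, rfl⟩
      · rintro ⟨h, h'⟩
        funext i
        refine Fin.lastCases h (fun j => congrFun h' j) i
    simp only [tens, Matrix.of_apply, hd]
    rw [ih', Fin.prod_univ_castSucc]
    have hx : s (Fin.last N) = 0 ∨ s (Fin.last N) = 1 := by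
      generalize s (Fin.last N) = x
      fin_cases x <;> simp
    rcases hx with hx | hx
    · simp [hs, hx, ell, downCfg, sigmaPlus, piPlus, piMinus]
    · by_cases hs' : (fun i : Fin N => s i.castSucc) = downCfg N
      · simp only [hs, hx, hs']
        simp [ell, downCfg, sigmaPlus, piPlus, piMinus, mul_comm]
      · simp [hs, hx, hs', ell, downCfg, sigmaPlus]

lemma Bop_succ {N : ℕ} (ν : Fin (N + 1) → ℂ) (l : ℂ) :
    Bop ν l = tens (Bop (fun i => ν i.castSucc) l) (ell l (ν (Fin.last N)) 0 0) +
      tens (Dop (fun i => ν i.castSucc) l) sigmaMinus := by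
  unfold Bop Dop
  rw [monodromy_succ, Fin.sum_univ_two]
  rfl

/-- the down-up block in the last tensor factor of a product of `B`s -/
def Qblk {N : ℕ} (ν : Fin N → ℂ) (v : ℂ) : List ℂ → Op N
  | [] => 0
  | l :: ls => bW l v • (Bop ν l * Qblk ν v ls) +
      (ls.map fun x => aW x v).prod • (Dop ν l * (ls.map (Bop ν)).prod)

lemma Bprod_succ {N : ℕ} (ν : Fin (N + 1) → ℂ) (ls : List ℂ) :
    (ls.map (Bop ν)).prod =
      tens (ls.map (Bop fun i => ν i.castSucc)).prod
        !![(ls.map fun x => aW x (ν (Fin.last N))).prod, 0;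
          0, (ls.map fun x => bW x (ν (Fin.last N))).prod] +
      tens (Qblk (fun i => ν i.castSucc) (ν (Fin.last N)) ls) sigmaMinus := by
  induction ls with
  | nil =>
    have h : tens (0 : Op N) sigmaMinus = 0 := by ext; simp [tens]
    simp only [List.map_nil, List.prod_nil, Qblk, h, add_zero]
    rw [← Matrix.one_fin_two, tens_one]
  | cons l ls ih =>
    simp only [List.map_cons, List.prod_cons]
    rw [ih, Bop_succ, add_mul, mul_add, mul_add, tens_mul, tens_mul, tens_mul, tens_mul]
    generalize hA : (ls.map fun x => aW x (ν (Fin.last N))).prod = A at *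
    generalize hP : (ls.map fun x => bW x (ν (Fin.last N))).prod = P at *
    have e1 : ell l (ν (Fin.last N)) 0 0 * !![A, 0; 0, P] =
        !![aW l (ν (Fin.last N)) * A, 0; 0, bW l (ν (Fin.last N)) * P] := by
      ext x y; fin_cases x <;> fin_cases y <;> simp [ell, piPlus, piMinus]
    have e2 : ell l (ν (Fin.last N)) 0 0 * sigmaMinus = bW l (ν (Fin.last N)) • sigmaMinus := by
      ext x y; fin_cases x <;> fin_cases y <;> simp [ell, piPlus, piMinus, sigmaMinus]
    have e3 : sigmaMinus * !![A, 0; 0, P] = A • sigmaMinus := by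
      ext x y; fin_cases x <;> fin_cases y <;> simp [sigmaMinus]
    have e4 : sigmaMinus * sigmaMinus = 0 := by
      ext x y; fin_cases x <;> fin_cases y <;> simp [sigmaMinus]
    have e5 (X : Op N) : tens X 0 = 0 := by ext; simp [tens]
    rw [e1, e2, e3, e4, e5, add_zero, Qblk, add_assoc, tens_add_left, tens_smul_left,
      tens_smul_left, tens_smul_right, tens_smul_right, hA]

def Zl {N : ℕ} (ν : Fin N → ℂ) (ls : List ℂ) : ℂ :=
  (ls.map (Bop ν)).prod (downCfg N) (upCfg N)

lemma Zl_perm {N : ℕ} (ν : Fin N → ℂ) {ls ls' : List ℂ} (h : ls.Perm ls') :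
    Zl ν ls = Zl ν ls' := by
  unfold Zl
  rw [(h.map (Bop ν)).prod_eq']
  exact List.pairwise_map.2 (List.pairwise_of_forall fun x y => Bop_commute ν x y)

lemma Zfun_eq_Zl {N : ℕ} (ν lam : Fin N → ℂ) :
    Zfun N ν lam = Zl ν ((List.finRange N).map lam) := by
  rw [← Zl_perm ν (List.reverse_perm _), ← List.map_reverse]
  simp only [Zfun, Zl, List.map_map]
  rfl

lemma Zl_succ {N : ℕ} (ν : Fin (N + 1) → ℂ) (ls : List ℂ) :
    Zl ν ls = Qblk (fun i => ν i.castSucc) (ν (Fin.last N)) ls (downCfg N) (upCfg N) := by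
  unfold Zl
  rw [Bprod_succ]
  simp [tens, sigmaMinus, downCfg, upCfg]
  rfl

lemma Zfun_special {N : ℕ} (ν : Fin (N + 1) → ℂ) (lam : Fin (N + 1) → ℂ) (m : Fin (N + 1))
    (h : ν (Fin.last N) = lam m) :
    Zfun (N + 1) ν lam = (∏ i, aW (lam (m.succAbove i)) (lam m)) *
      (∏ k : Fin N, aW (lam m) (ν k.castSucc)) *
      Zfun N (fun i => ν i.castSucc) (fun i => lam (m.succAbove i)) := by
  have hp : ((List.finRange (N + 1)).map lam).Perm
      (lam m :: (List.finRange N).map fun i => lam (m.succAbove i)) := by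
    have : (List.finRange (N + 1)).Perm (m :: (List.finRange N).map m.succAbove) := by
      rw [List.perm_ext_iff_of_nodup (List.nodup_finRange _)]
      · intro a
        simp only [List.mem_finRange, List.mem_cons, List.mem_map, true_and, true_iff]
        rcases Fin.eq_self_or_eq_succAbove m a with h | ⟨j, h⟩
        · exact Or.inl h
        · exact Or.inr ⟨j, h.symm⟩
      · refine List.nodup_cons.2 ⟨?_, (List.nodup_finRange _).map Fin.succAbove_right_injective⟩
        simp [Fin.succAbove_ne]
    simpa [Function.comp_def] using this.map lam
  rw [Zfun_eq_Zl, Zl_perm ν hp, Zl_succ, Qblk, h, Zfun_eq_Zl]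
  have hb : bW (lam m) (lam m) = 0 := by simp [bW]
  rw [hb, zero_smul, zero_add, Matrix.smul_apply, Matrix.mul_apply]
  simp only [Dop_down, ite_mul, zero_mul, Finset.sum_ite_eq', Finset.mem_univ, if_true]
  rw [List.map_map, smul_eq_mul, mul_assoc]
  rw [← List.prod_ofFn, List.ofFn_eq_map]
  rfl

open Polynomial in
lemma Qblk_poly {N : ℕ} (ν : Fin N → ℂ) (ls : List ℂ) (s s' : Cfg N) :
    ∃ p : ℂ[X], p.degree < (ls.length : ℕ) ∧ ∀ v, Qblk ν v ls s s' = p.eval v := by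
  induction ls generalizing s with
  | nil => exact ⟨0, by simp, fun v => by simp [Qblk]⟩
  | cons l ls ih =>
    choose p hp hpe using ih
    have hd (c : ℂ) : (C c - X).degree = 1 := by
      rw [← neg_sub, degree_neg, degree_X_sub_C]
    have hA : ((ls.map fun x => C (x + 1) - X).prod : ℂ[X]).degree ≤ (ls.length : ℕ) := by
      clear hp hpe p
      induction ls with
      | nil => simp
      | cons x xs ih =>
        simp only [List.map_cons, List.prod_cons, List.length_cons, degree_mul, hd]
        rw [Nat.cast_add, add_comm, Nat.cast_one]
        gcongr
    refine ⟨(C l - X) * ∑ t, C (Bop ν l s t) * p t +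
      (ls.map fun x => C (x + 1) - X).prod * C ((Dop ν l * (ls.map (Bop ν)).prod) s s'), ?_, ?_⟩
    · refine (degree_add_le _ _).trans_lt (max_lt ?_ ?_)
      · by_cases h0 : ∑ t, C (Bop ν l s t) * p t = 0
        · rw [h0, mul_zero, degree_zero]; exact WithBot.bot_lt_coe _
        have : (∑ t, C (Bop ν l s t) * p t).degree < (ls.length : ℕ) := by
          refine (degree_sum_le _ _).trans_lt ?_
          rw [Finset.sup_lt_iff (WithBot.bot_lt_coe _)]
          intro t _
          refine lt_of_le_of_lt ?_ (hp t)
          rw [← smul_eq_C_mul]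
          exact degree_smul_le _ _
        rw [degree_mul, hd, List.length_cons]
        rw [degree_eq_natDegree h0] at this ⊢
        norm_cast at this ⊢
        omega
      · refine (degree_mul_le _ _).trans_lt ?_
        have := add_le_add hA (degree_C_le (a := (Dop ν l * (ls.map (Bop ν)).prod) s s'))
        refine this.trans_lt ?_
        rw [List.length_cons, add_zero]
        norm_cast
        omega
    · intro v
      rw [Qblk, Matrix.add_apply, Matrix.smul_apply, Matrix.smul_apply, Matrix.mul_apply]
      simp only [hpe, eval_add, eval_mul, eval_sub, eval_C, eval_X, eval_finsetSum, smul_eq_mul,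
        eval_list_prod, List.map_map]
      congr 2
      congr 2
      funext x
      simp [aW]; ring

lemma sgn_count (n : ℕ) (m : ℕ) (hm : m ≤ n) :
    ∏ i : Fin n, (if i.val < m then (-1 : ℂ) else 1) = (-1) ^ m := by
  rw [Fin.prod_univ_eq_prod_range (fun i => if i < m then (-1 : ℂ) else 1) n,
    Finset.prod_ite, Finset.prod_const, Finset.prod_const_one, mul_one]
  congr 1
  have : Finset.filter (fun x => x < m) (Finset.range n) = Finset.range m := by
    ext x; simp; omega
  rw [this, Finset.card_range]

def Delta {n : ℕ} (x : Fin n → ℂ) : ℂ := ∏ j, ∏ k ∈ Finset.Ioi j, (x k - x j)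

lemma Delta_eq {n : ℕ} (x : Fin n → ℂ) :
    Delta x = ∏ j, ∏ k, if j < k then (x k - x j) else 1 := by
  unfold Delta
  refine Finset.prod_congr rfl fun j _ => ?_
  rw [← Finset.prod_filter]
  congr 1
  ext; simp

lemma Delta_succAbove {n : ℕ} (x : Fin (n + 1) → ℂ) (m : Fin (n + 1)) :
    Delta x = (-1) ^ (m : ℕ) * (∏ i, (x (m.succAbove i) - x m)) *
      Delta (fun i => x (m.succAbove i)) := by
  rw [Delta_eq, Delta_eq, Fin.prod_univ_succAbove _ m, Fin.prod_univ_succAbove _ m]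
  simp only [lt_irrefl, if_false, one_mul]
  have h0 (i : Fin n) : (∏ k, if m.succAbove i < k then (x k - x (m.succAbove i)) else 1) =
      (if m.succAbove i < m then (x m - x (m.succAbove i)) else 1) *
      ∏ k, if i < k then (x (m.succAbove k) - x (m.succAbove i)) else 1 := by
    rw [Fin.prod_univ_succAbove _ m]
    simp only [Fin.succAbove_lt_succAbove_iff]
  rw [Finset.prod_congr rfl fun i _ => h0 i]
  rw [Finset.prod_mul_distrib, ← mul_assoc, ← Finset.prod_mul_distrib,
    ← sgn_count n m (by omega)]
  rw [← Finset.prod_mul_distrib]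
  rw [← Finset.prod_mul_distrib, ← Finset.prod_mul_distrib]
  refine Finset.prod_congr rfl fun i _ => ?_
  congr 1
  by_cases h : i.castSucc < m
  · rw [if_neg, if_pos, if_pos]
    · ring
    · exact h
    · exact (Fin.succAbove_lt_iff_castSucc_lt m i).2 h
    · exact not_lt.2 ((Fin.succAbove_lt_iff_castSucc_lt m i).2 h).le
  · have h' : m < m.succAbove i := (Fin.lt_succAbove_iff_le_castSucc m i).2 (not_lt.1 h)
    rw [if_pos h', if_neg h'.le.not_gt, if_neg]
    · ring
    · exact h

lemma Delta_last {n : ℕ} (x : Fin (n + 1) → ℂ) :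
    Delta x = (∏ i : Fin n, (x (Fin.last n) - x i.castSucc)) *
      Delta (fun i => x i.castSucc) := by
  rw [Delta_succAbove x (Fin.last n)]
  simp only [Fin.succAbove_last, Fin.val_last]
  congr 1
  rw [← Fin.prod_const, ← Finset.prod_mul_distrib]
  refine Finset.prod_congr rfl fun i _ => ?_
  ring

def wW (l v : ℂ) : ℂ := (l - v + 1) * (l - v)

def IKdet {n : ℕ} (ν lam : Fin n → ℂ) : ℂ :=
  Matrix.det (Matrix.of fun j k : Fin n => 1 / wW (lam j) (ν k))

lemma det_expand {N : ℕ} (ν : Fin (N + 1) → ℂ) (lam : Fin (N + 1) → ℂ)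
    (h : ∀ j, wW (lam j) (ν (Fin.last N)) ≠ 0) :
    (∏ j, ∏ k, wW (lam j) (ν k)) * IKdet ν lam =
      (∏ j, ∏ k : Fin N, wW (lam j) (ν k.castSucc)) *
      ∑ m : Fin (N + 1), ((-1) ^ (m + N : ℕ) *
        IKdet (fun k => ν k.castSucc) (fun i => lam (m.succAbove i))) *
        ∏ i, wW (lam (m.succAbove i)) (ν (Fin.last N)) := by
  unfold IKdet
  rw [Matrix.det_succ_column _ (Fin.last N)]
  simp_rw [Fin.prod_univ_castSucc (f := fun k => wW _ (ν k))]
  rw [Finset.prod_mul_distrib, mul_assoc]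
  congr 1
  rw [Finset.mul_sum]
  refine Finset.sum_congr rfl fun m _ => ?_
  rw [Fin.prod_univ_succAbove _ m, Fin.succAbove_last]
  simp only [Matrix.of_apply, Fin.val_last]
  have hs : (Matrix.of fun j k : Fin (N + 1) => 1 / wW (lam j) (ν k)).submatrix m.succAbove
      Fin.castSucc = Matrix.of fun j k : Fin N => 1 / wW (lam (m.succAbove j)) (ν k.castSucc) := rfl
  rw [hs]
  have := h m
  field_simp

lemma sgn_succ (N : ℕ) : (-1 : ℂ) ^ ((N + 1) * (N + 1 - 1) / 2) =
    (-1) ^ N * (-1) ^ (N * (N - 1) / 2) := by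
  rw [← pow_add]
  congr 1
  have : (N + 1) * (N + 1 - 1) = N * (N - 1) + N * 2 := by
    cases N with
    | zero => rfl
    | succ n => simp only [Nat.add_sub_cancel]; ring
  rw [this, Nat.add_mul_div_right _ _ (by norm_num)]
  ring

open Polynomial in
lemma IK_main (N : ℕ) (ν lam : Fin N → ℂ) (hν : Function.Injective ν)
    (hlam : Function.Injective lam) (h : ∀ j k, wW (lam j) (ν k) ≠ 0) :
    Zfun N ν lam * (Delta lam * Delta ν) =
      (-1 : ℂ) ^ (N * (N - 1) / 2) * ((∏ j, ∏ k, wW (lam j) (ν k)) * IKdet ν lam) := by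
  induction N with
  | zero => simp [Zfun, Delta, IKdet, Subsingleton.elim (downCfg 0) (upCfg 0)]
  | succ N ih =>
    set ν' : Fin N → ℂ := fun k => ν k.castSucc with hν'
    obtain ⟨p, hpd, hp⟩ := Qblk_poly ν' ((List.finRange (N + 1)).map lam) (downCfg N) (upCfg N)
    have hZ (v : ℂ) : p.eval v = Zfun (N + 1) (Fin.snoc (α := fun _ => ℂ) ν' v) lam := by
      rw [Zfun_eq_Zl, Zl_succ, ← hp]
      simp
    have hν'i : Function.Injective ν' := fun a b hab => Fin.castSucc_injective _ (hν hab)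
    let F : ℂ[X] := p * (C (Delta lam * Delta ν') * ∏ k, (X - C (ν' k)))
    let wp : ℂ → ℂ[X] := fun x => (C (x + 1) - X) * (C x - X)
    let cc : Fin (N + 1) → ℂ := fun m => (-1) ^ (m + N : ℕ) *
        IKdet ν' (fun i => lam (m.succAbove i))
    let W0 : ℂ := ∏ j, ∏ k : Fin N, wW (lam j) (ν' k)
    let sg : ℂ := (-1 : ℂ) ^ ((N + 1) * (N + 1 - 1) / 2)
    let G : ℂ[X] := C (sg * W0) * ∑ m, C (cc m) * ∏ i, wp (lam (m.succAbove i))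
    have hwp (x v : ℂ) : (wp x).eval v = wW x v := by
      simp [wp, wW]; ring_nf; simp
    have hF (v : ℂ) : F.eval v = p.eval v * (Delta lam * Delta ν' * ∏ k, (v - ν' k)) := by
      simp [F, eval_prod]
    have hG (v : ℂ) : G.eval v =
        sg * (W0 * ∑ m, cc m * ∏ i, wW (lam (m.succAbove i)) v) := by
      simp only [G, eval_mul, eval_C, eval_finsetSum, eval_prod, hwp]; ring
    have hFd : F.degree < ((2 * N + 1 : ℕ) : WithBot ℕ) := by
      have h1 : p.degree ≤ ((N : ℕ) : WithBot ℕ) := by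
        rw [List.length_map, List.length_finRange] at hpd
        by_cases h0 : p = 0
        · simp [h0]
        rw [degree_eq_natDegree h0] at hpd ⊢
        norm_cast at hpd ⊢
        omega
      have h2 : (∏ k, (X - C (ν' k))).degree ≤ ((N : ℕ) : WithBot ℕ) := by
        rw [degree_prod]; simp
      have h3 : (C (Delta lam * Delta ν') * ∏ k, (X - C (ν' k))).degree ≤ ((N : ℕ) : WithBot ℕ) := by
        rw [← smul_eq_C_mul]; exact (degree_smul_le _ _).trans h2
      refine (degree_mul_le _ _).trans_lt ((add_le_add h1 h3).trans_lt ?_)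
      norm_cast; omega
    have hGd : G.degree < ((2 * N + 1 : ℕ) : WithBot ℕ) := by
      have hd (c : ℂ) : (C c - X).degree = 1 := by
        rw [← neg_sub, degree_neg, degree_X_sub_C]
      have h1 : G.degree ≤ ((2 * N : ℕ) : WithBot ℕ) := by
        simp only [G, ← smul_eq_C_mul]
        refine (degree_smul_le _ _).trans ((degree_sum_le _ _).trans (Finset.sup_le fun m _ => ?_))
        refine (degree_smul_le _ _).trans ?_
        rw [degree_prod]
        simp only [wp, degree_mul, hd]
        simp
        norm_cast
        omega
      refine h1.trans_lt ?_
      norm_cast; omega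
    have hne (j : Fin (N + 1)) (k : Fin (N + 1)) : lam j ≠ ν k := by
      intro e; exact h j k (by simp [wW, e])
    have hcard : (Finset.univ.image lam ∪ Finset.univ.image ν').card = 2 * N + 1 := by
      rw [Finset.card_union_of_disjoint, Finset.card_image_of_injective _ hlam,
        Finset.card_image_of_injective _ hν'i]
      · simp; omega
      · rw [Finset.disjoint_left]
        intro x hx hx'
        simp only [Finset.mem_image, Finset.mem_univ, true_and] at hx hx'
        obtain ⟨j, rfl⟩ := hx
        obtain ⟨k, hk⟩ := hx'
        exact hne j k.castSucc hk.symm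
    have hexp (v : ℂ) (hv : ∀ j, wW (lam j) v ≠ 0) :
        G.eval v = sg * ((∏ j, ∏ k, wW (lam j) (Fin.snoc (α := fun _ => ℂ) ν' v k)) *
          IKdet (Fin.snoc (α := fun _ => ℂ) ν' v) lam) := by
      rw [hG, det_expand _ _ (by simpa using hv)]
      simp [W0, cc]
    have hFG : F = G := by
      refine eq_of_degrees_lt_of_eval_finset_eq (Finset.univ.image lam ∪ Finset.univ.image ν')
        (by rw [hcard]; exact hFd) (by rw [hcard]; exact hGd) ?_
      intro x hx
      simp only [Finset.mem_union, Finset.mem_image, Finset.mem_univ, true_and] at hx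
      rcases hx with ⟨m, rfl⟩ | ⟨k, rfl⟩
      · have ihm := ih ν' (fun i => lam (m.succAbove i)) hν'i
          (hlam.comp Fin.succAbove_right_injective) (fun j k => h _ _)
        rw [hF, hG, hZ, Zfun_special _ _ m (by simp), Finset.sum_eq_single m]
        · simp only [Fin.snoc_castSucc, W0, cc]
          rw [Delta_succAbove lam m, Fin.prod_univ_succAbove _ m]
          simp only [wW, Finset.prod_mul_distrib] at ihm ⊢
          simp only [aW]
          have hs : sg = (-1) ^ N * (-1) ^ (N * (N - 1) / 2) := sgn_succ N
          rw [hs, pow_add]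
          have hsq : ((-1 : ℂ) ^ N) * (-1) ^ N = 1 := by
            rw [← mul_pow]; simp
          generalize ((-1 : ℂ) ^ N) = e at *
          generalize ((-1 : ℂ) ^ (N * (N - 1) / 2)) = e' at *
          set A1 := ∏ i, (lam (m.succAbove i) - lam m + 1)
          set A2 := ∏ x, (lam m - ν' x + 1)
          set A3 := ∏ i, (lam (m.succAbove i) - lam m)
          set A4 := ∏ k, (lam m - ν' k)
          set B1 := ∏ x, ∏ y, (lam (m.succAbove x) - ν' y + 1)
          set B2 := ∏ x, ∏ y, (lam (m.succAbove x) - ν' y)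
          linear_combination (A1 * A2 * A3 * A4 * (-1) ^ (m : ℕ)) * ihm -
            (A1 * A2 * A3 * A4 * (-1) ^ (m : ℕ)) *
              (e' * (B1 * B2 * IKdet ν' fun i => lam (m.succAbove i))) * hsq
        · intro m' _ hm'
          obtain ⟨i, hi⟩ := Fin.exists_succAbove_eq hm'.symm
          rw [Finset.prod_eq_zero (Finset.mem_univ i), mul_zero]
          simp [hi, wW]
        · simp
      · rw [hF, hexp _ (fun j => h j _), Finset.prod_eq_zero (Finset.mem_univ k) (sub_self _)]
        have : IKdet (Fin.snoc (α := fun _ => ℂ) ν' (ν' k)) lam = 0 := by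
          refine Matrix.det_zero_of_column_eq (Fin.castSucc_lt_last k).ne fun i => ?_
          simp
        rw [this]; simp
    have hsn : (Fin.snoc (α := fun _ => ℂ) ν' (ν (Fin.last N)) : Fin (N + 1) → ℂ) = ν :=
      Fin.snoc_init_self (α := fun _ => ℂ) ν
    have := congrArg (eval (ν (Fin.last N))) hFG
    rw [hF, hexp _ (fun j => h j _), hZ, hsn] at this
    rw [Delta_last ν, ← this]
    ring

end SixVertex
end

open SixVertex in
/-- Izergin–Korepin representation, rational case. -/
theorem Zfun_IK (N : ℕ) (hN : 1 ≤ N) (ν : Fin N → ℂ)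
    (hν : Function.Injective ν) (lam : Fin N → ℂ)
    (hlam : Function.Injective lam)
    (hlν : ∀ j k : Fin N, lam j - ν k ≠ 0 ∧ lam j - ν k ≠ -1) :
    Zfun N ν lam =
      (-1 : ℂ) ^ (N * (N - 1) / 2) *
        ((∏ j, ∏ k, (lam j - ν k + 1) * (lam j - ν k)) /
          ((∏ j, ∏ k ∈ Finset.Ioi j, (lam k - lam j)) *
            ∏ j, ∏ k ∈ Finset.Ioi j, (ν k - ν j))) *
        Matrix.det (Matrix.of fun j k : Fin N =>
          1 / ((lam j - ν k + 1) * (lam j - ν k))) := by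
  have hw : ∀ j k, wW (lam j) (ν k) ≠ 0 := fun j k =>
    mul_ne_zero (fun h => (hlν j k).2 (eq_neg_of_add_eq_zero_left h)) (hlν j k).1
  have key := IK_main N ν lam hν hlam hw
  have hD : ∀ x : Fin N → ℂ, Function.Injective x → Delta x ≠ 0 := fun x hx =>
    Finset.prod_ne_zero_iff.2 fun j _ => Finset.prod_ne_zero_iff.2 fun k hk =>
      sub_ne_zero.2 fun e => (Finset.mem_Ioi.1 hk).ne' (hx e)
  have h1 := hD lam hlam
  have h2 := hD ν hν
  change Zfun N ν lam = (-1 : ℂ) ^ (N * (N - 1) / 2) *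
    ((∏ j, ∏ k, wW (lam j) (ν k)) / (Delta lam * Delta ν)) * IKdet ν lam
  rw [eq_div_of_mul_eq (mul_ne_zero h1 h2) key]
  ring
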